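/- arXiv:2306.07485 — 4 statements merged into one kernel-verified Lean document; each statement's English description precedes it below -/
import Mathlib

section
/- Let μ > 0 and η₀ > 0, and define η_t for t ≥ 1 by 1/η_t = μ/2 + √(μ²/4 + 1/η_{t−1}²). Then every η_t is positive and satisfies 1 − μη_t = η_t²/η_{t−1}², and for every T ≥ 1 one has 1/η_T ≥ μT/2 + 1/η₀; in particular η_T ≤ 2/(μT). -/
/-- The step-size recursion `1/η_t = μ/2 + √(μ²/4 + 1/η_{t-1}²)` (with `μ, η₀ > 0`)
produces positive step sizes satisfying `1 - μ η_t = η_t²/η_{t-1}²`, and for every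
`T ≥ 1` one has `1/η_T ≥ μ T / 2 + 1/η₀`; in particular `η_T ≤ 2/(μ T)`. -/
theorem stmt_11 (μ η₀ : ℝ) (hμ : 0 < μ) (hη₀ : 0 < η₀)
    (η : ℕ → ℝ) (h0 : η 0 = η₀)
    (hrec : ∀ t, 1 ≤ t →
      η t = 1 / (μ / 2 + Real.sqrt (μ ^ 2 / 4 + 1 / (η (t - 1)) ^ 2))) :
    (∀ t, 0 < η t) ∧
      (∀ t, 1 ≤ t → 1 - μ * η t = (η t) ^ 2 / (η (t - 1)) ^ 2) ∧
      (∀ T : ℕ, 1 ≤ T → μ * T / 2 + 1 / η₀ ≤ 1 / η T) ∧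
      (∀ T : ℕ, 1 ≤ T → η T ≤ 2 / (μ * T)) := by
  have hpos : ∀ t, 0 < η t := by
    intro t
    cases t with
    | zero => exact h0 ▸ hη₀
    | succ t =>
      rw [hrec (t + 1) (by omega)]
      positivity
  have hinv : ∀ t, 1 ≤ t →
      1 / η t = μ / 2 + Real.sqrt (μ ^ 2 / 4 + 1 / (η (t - 1)) ^ 2) := by
    intro t ht
    rw [hrec t ht, one_div_one_div]
  have hlower : ∀ T : ℕ, μ * T / 2 + 1 / η₀ ≤ 1 / η T := by
    intro T
    induction T with
    | zero => simp [h0]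
    | succ T ih =>
      have hsqrt : 1 / η T ≤ Real.sqrt (μ ^ 2 / 4 + 1 / (η T) ^ 2) := by
        apply Real.le_sqrt_of_sq_le
        rw [one_div_pow]
        linarith [sq_nonneg μ]
      rw [hinv (T + 1) (by omega), Nat.add_sub_cancel]
      push_cast
      linarith
  refine ⟨hpos, ?_, fun T _ => hlower T, ?_⟩
  · intro t ht
    have hsq := Real.sq_sqrt (show 0 ≤ μ ^ 2 / 4 + 1 / (η (t - 1)) ^ 2 by positivity)
    rw [← sub_eq_of_eq_add' (hinv t ht)] at hsq
    have hquad : 1 / (η (t - 1)) ^ 2 = (1 / η t) ^ 2 - μ * (1 / η t) := by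
      linear_combination -hsq
    have hne := (hpos t).ne'
    rw [div_eq_mul_one_div, hquad]
    field_simp
  · intro T hT
    have hT' : (0 : ℝ) < T := by exact_mod_cast hT
    have hle : μ * T / 2 ≤ 1 / η T := by
      have := hlower T
      have : 0 < 1 / η₀ := by positivity
      linarith
    have hbound := one_div_le_one_div_of_le (by positivity) hle
    rwa [one_div_one_div, one_div_div] at hbound
end

section
/- (Argmax consistency.) Let (Θ, d) be a metric space, M : Θ → ℝ, and θ* ∈ Θ such that for every ε > 0 there exists δ > 0 with M(θ) ≥ M(θ*) + δ whenever d(θ, θ*) ≥ ε (well-separated minimum). Let (Ω, 𝓕, P) be a probability space and for each n let M_n : Ω × Θ → ℝ be a random function and θ̂_n : Ω → Θ a measurable map with M_n(ω, θ̂_n(ω)) ≤ M_n(ω, θ*) for all ω. Assume the maps ω ↦ sup_{θ∈Θ} |M_n(ω, θ) − M(θ)| and ω ↦ d(θ̂_n(ω), θ*) are measurable, and that sup_{θ∈Θ} |M_n(·, θ) − M(θ)| → 0 in probability. Then θ̂_n → θ* in probability: for every ε > 0, P(d(θ̂_n, θ*) > ε) → 0 as n → ∞. -/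
open MeasureTheory Filter

/-- Argmax consistency: if `θ*` is a well-separated minimum of `M`, the estimators
`θ̂_n` are near-minimizers of the random criteria `M_n`, and
`sup_θ |M_n(·, θ) - M θ| → 0` in probability, then `θ̂_n → θ*` in probability.
(The event "`sup_θ |M_n(ω, θ) - M θ| > ε`" is expressed as
"`∃ θ, ε < |M_n(ω, θ) - M θ|`".) -/
theorem stmt_12 {Θ : Type*} [MetricSpace Θ] {Ω : Type*} [MeasurableSpace Ω]
    (P : Measure Ω) [IsProbabilityMeasure P]
    (M : Θ → ℝ) (θstar : Θ)
    (hsep : ∀ ε > (0 : ℝ), ∃ δ > (0 : ℝ), ∀ θ, ε ≤ dist θ θstar → M θstar + δ ≤ M θ)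
    (Mn : ℕ → Ω → Θ → ℝ) (θhat : ℕ → Ω → Θ)
    (hmin : ∀ n ω, Mn n ω (θhat n ω) ≤ Mn n ω θstar)
    (hmeassup : ∀ n, ∀ ε : ℝ, MeasurableSet {ω | ∃ θ, ε < |Mn n ω θ - M θ|})
    (hmeasd : ∀ n, Measurable fun ω => dist (θhat n ω) θstar)
    (hconv : ∀ ε > (0 : ℝ),
      Tendsto (fun n => P {ω | ∃ θ, ε < |Mn n ω θ - M θ|}) atTop (nhds 0)) :
    ∀ ε > (0 : ℝ),
      Tendsto (fun n => P {ω | ε < dist (θhat n ω) θstar}) atTop (nhds 0) := by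
  intro ε hε
  obtain ⟨δ, hδ, hM⟩ := hsep ε hε
  refine tendsto_of_tendsto_of_tendsto_of_le_of_le tendsto_const_nhds
    (hconv (δ / 3) (by positivity)) (fun _ => zero_le) fun n => measure_mono fun ω hω => ?_
  by_contra hdev
  have hunif : ∀ θ, |Mn n ω θ - M θ| ≤ δ / 3 := fun θ => le_of_not_gt fun h => hdev ⟨θ, h⟩
  have hhat := (abs_le.mp (hunif (θhat n ω))).1
  have hstar := (abs_le.mp (hunif θstar)).2
  linarith [hM (θhat n ω) (le_of_lt hω), hmin n ω]
end

section
/- (Lyapunov contraction under the PL condition.) Let C, L, μ, A > 0, set L₀ := (C² + C + 1)L and B := 36C²L²A, and let K_b, K_c ≥ 0. Let (a_t), (b_t), (c_t), (d_t) be nonnegative real sequences and (η_t) positive reals such that β_{t+1} := max{2μ, 1/A, 8A(2L₀² + 36C⁴L²)}·η_t ∈ (0, 1] and, for every t ≥ 1: (i) a_{t+1} ≤ (1 − μη_t)a_t + (η_t/2)b_t − (η_t/4)d_t²; (ii) b_{t+1} ≤ (1 − β_{t+1})b_t + ((2L₀² + 18C⁴L²)/β_{t+1})·η_t² d_t² +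 18β_{t+1}C²L²·c_t + β_{t+1}²·K_b; (iii) c_{t+1} ≤ (1 − β_{t+1})c_t + (C²η_t²/β_{t+1})·d_t² + β_{t+1}²·K_c. Then the Lyapunov sequence Γ_t := a_t + A·b_t + B·c_t satisfies Γ_{t+1} ≤ (1 − μη_t)·Γ_t + β_{t+1}²·(A·K_b + B·K_c) for every t ≥ 1. -/
/-- Lyapunov contraction under the PL condition (deterministic core of Theorem 4):
combining the descent inequality, the gradient-estimator error recursion and the
inner-function estimator error recursion, the Lyapunov sequence
`Γ_t = a_t + A b_t + B c_t` contracts at rate `1 - μ η_t` with additive noise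
`β_{t+1}² (A K_b + B K_c)`. -/
theorem stmt_16 (C L μ A : ℝ) (hC : 0 < C) (hL : 0 < L) (hμ : 0 < μ) (hA : 0 < A)
    (L₀ B : ℝ) (hL₀ : L₀ = (C ^ 2 + C + 1) * L) (hB : B = 36 * C ^ 2 * L ^ 2 * A)
    (Kb Kc : ℝ) (hKb : 0 ≤ Kb) (hKc : 0 ≤ Kc)
    (a b c d η : ℕ → ℝ)
    (ha : ∀ t, 0 ≤ a t) (hb : ∀ t, 0 ≤ b t) (hc : ∀ t, 0 ≤ c t) (hd : ∀ t, 0 ≤ d t)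
    (hη : ∀ t, 0 < η t)
    (β : ℕ → ℝ)
    (hβ : ∀ t, β (t + 1) =
      max (max (2 * μ) (1 / A)) (8 * A * (2 * L₀ ^ 2 + 36 * C ^ 4 * L ^ 2)) * η t)
    (hβle : ∀ t, β (t + 1) ≤ 1)
    (hi : ∀ t, 1 ≤ t →
      a (t + 1) ≤ (1 - μ * η t) * a t + η t / 2 * b t - η t / 4 * d t ^ 2)
    (hii : ∀ t, 1 ≤ t →
      b (t + 1) ≤ (1 - β (t + 1)) * b t
        + (2 * L₀ ^ 2 + 18 * C ^ 4 * L ^ 2) / β (t + 1) * η t ^ 2 * d t ^ 2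
        + 18 * β (t + 1) * C ^ 2 * L ^ 2 * c t + β (t + 1) ^ 2 * Kb)
    (hiii : ∀ t, 1 ≤ t →
      c (t + 1) ≤ (1 - β (t + 1)) * c t
        + C ^ 2 * η t ^ 2 / β (t + 1) * d t ^ 2 + β (t + 1) ^ 2 * Kc) :
    ∀ t, 1 ≤ t →
      a (t + 1) + A * b (t + 1) + B * c (t + 1)
        ≤ (1 - μ * η t) * (a t + A * b t + B * c t)
          + β (t + 1) ^ 2 * (A * Kb + B * Kc) := by
  intro t ht
  have hη := hη t
  have hb := hb t
  have hc := hc t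
  have hi := hi t ht
  have hii := hii t ht
  have hiii := hiii t ht
  have hβ := hβ t
  clear ha hd hβle
  generalize β (t + 1) = s at *
  have hμs : 2 * μ * η t ≤ s := by
    rw [hβ]; gcongr; exact (le_max_left _ _).trans (le_max_left _ _)
  have hηs : η t ≤ A * s := by
    have h : 1 / A * η t ≤ s := by
      rw [hβ]; gcongr; exact (le_max_right _ _).trans (le_max_left _ _)
    rwa [one_div, inv_mul_le_iff₀ hA] at h
  have hVs : 8 * A * (2 * L₀ ^ 2 + 36 * C ^ 4 * L ^ 2) * η t ≤ s := by
    rw [hβ]; gcongr; exact le_max_right _ _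
  have hs : 0 < s := lt_of_lt_of_le (by positivity) hμs
  have hB0 : 0 < B := by rw [hB]; positivity
  -- the total coefficient of `d t ^ 2` is nonpositive
  have hcoef : A * ((2 * L₀ ^ 2 + 18 * C ^ 4 * L ^ 2) / s * η t ^ 2)
      + B * (C ^ 2 * η t ^ 2 / s) ≤ η t / 4 := by
    have h : A * ((2 * L₀ ^ 2 + 18 * C ^ 4 * L ^ 2) / s * η t ^ 2)
        + B * (C ^ 2 * η t ^ 2 / s)
        = A * (2 * L₀ ^ 2 + 54 * C ^ 4 * L ^ 2) * η t * η t / s := by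
      rw [hB]; ring
    rw [h, div_le_iff₀ hs]
    have h₁ : 0 ≤ A * (2 * L₀ ^ 2 + 18 * C ^ 4 * L ^ 2) * η t := by positivity
    have h₂ : A * (2 * L₀ ^ 2 + 54 * C ^ 4 * L ^ 2) * η t ≤ s / 4 := by linarith
    linarith [mul_le_mul_of_nonneg_right h₂ hη.le]
  have hd' := mul_le_mul_of_nonneg_right hcoef (sq_nonneg (d t))
  have hb' : (η t / 2 + A * (μ * η t)) * b t ≤ A * s * b t := by
    gcongr
    linarith [mul_le_mul_of_nonneg_left hμs hA.le]
  have hc' := mul_le_mul_of_nonneg_right (mul_le_mul_of_nonneg_left hμs hB0.le) hc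
  have hBc : A * (18 * s * C ^ 2 * L ^ 2 * c t) = B * s * c t / 2 := by
    rw [hB]; ring
  linarith [mul_le_mul_of_nonneg_left hii hA.le, mul_le_mul_of_nonneg_left hiii hB0.le]
end

section
/- (Deterministic core of the non-convex convergence rate.) Let ε, η, β > 0, a₁ ≥ 0, L₂, L₃, L₄ ≥ 0, T ≥ 1, and let (a_t)_{t=1}^{T+1}, (g_t)_{t=1}^{T}, (b_t)_{t=1}^{T}, (d_t)_{t=1}^{T} be nonnegative real sequences satisfying: (i) a_{t+1} ≤ a_t − (η/2)g_t + (η/2)b_t − (η/4)d_t² for t = 1, …, T; and (ii) Σ_{t=1}^T b_t ≤ L₂/β + (L₄η²/β²)·Σ_{t=1}^T d_t² + L₃βT. If moreover L₄η² ≤ β²/2, L₃β ≤ ε²/3, L₂/(βT) ≤ ε²/3, and 2a₁/(ηT) ≤ ε²/3, then (1/T)·Σ_{t=1}^T g_t ≤ ε². -/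
/-- Telescoping of a per-step descent inequality. -/
theorem sum_descent_le (η : ℝ) (a g b d : ℕ → ℝ) (T : ℕ)
    (h : ∀ t, 1 ≤ t → t ≤ T →
      a (t + 1) ≤ a t - η / 2 * g t + η / 2 * b t - η / 4 * d t ^ 2) :
    a (T + 1) ≤ a 1 - η / 2 * ∑ t ∈ Finset.Icc 1 T, g t
      + η / 2 * ∑ t ∈ Finset.Icc 1 T, b t - η / 4 * ∑ t ∈ Finset.Icc 1 T, d t ^ 2 := by
  induction T with
  | zero => simp
  | succ n ih =>
    have h₁ := ih fun t ht htn => h t ht (by omega)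
    have h₂ := h (n + 1) (by omega) le_rfl
    simp only [Finset.sum_Icc_succ_top (Nat.le_add_left 1 n)]
    linarith

/-- Deterministic core of the non-convex convergence rate (Theorem 3): if the objective
gaps `a_t`, squared gradient norms `g_t`, gradient-estimation errors `b_t` and update
magnitudes `d_t` satisfy the per-step descent inequality and the aggregate bound on
`Σ b_t`, and the parameters satisfy `L₄ η² ≤ β²/2`, `L₃ β ≤ ε²/3`, `L₂/(β T) ≤ ε²/3`,
`2 a₁/(η T) ≤ ε²/3`, then the average squared gradient norm is at most `ε²`. -/
theorem stmt_18 (ε η β : ℝ) (hε : 0 < ε) (hη : 0 < η) (hβ : 0 < β)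
    (L₂ L₃ L₄ : ℝ) (hL₂ : 0 ≤ L₂) (hL₃ : 0 ≤ L₃) (hL₄ : 0 ≤ L₄)
    (T : ℕ) (hT : 1 ≤ T)
    (a g b d : ℕ → ℝ)
    (ha : ∀ t, 0 ≤ a t) (hg : ∀ t, 0 ≤ g t) (hb : ∀ t, 0 ≤ b t) (hd : ∀ t, 0 ≤ d t)
    (hi : ∀ t, 1 ≤ t → t ≤ T →
      a (t + 1) ≤ a t - η / 2 * g t + η / 2 * b t - η / 4 * d t ^ 2)
    (hii : ∑ t ∈ Finset.Icc 1 T, b t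
      ≤ L₂ / β + L₄ * η ^ 2 / β ^ 2 * ∑ t ∈ Finset.Icc 1 T, d t ^ 2 + L₃ * β * T)
    (hcond1 : L₄ * η ^ 2 ≤ β ^ 2 / 2)
    (hcond2 : L₃ * β ≤ ε ^ 2 / 3)
    (hcond3 : L₂ / (β * T) ≤ ε ^ 2 / 3)
    (hcond4 : 2 * a 1 / (η * T) ≤ ε ^ 2 / 3) :
    (1 / T : ℝ) * ∑ t ∈ Finset.Icc 1 T, g t ≤ ε ^ 2 := by
  have hT₀ : (0 : ℝ) < T := by exact_mod_cast hT
  have hdescent := sum_descent_le η a g b d T hi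
  have hlast := ha (T + 1)
  have hD : 0 ≤ ∑ t ∈ Finset.Icc 1 T, d t ^ 2 := Finset.sum_nonneg fun t _ => sq_nonneg _
  set G := ∑ t ∈ Finset.Icc 1 T, g t
  set B := ∑ t ∈ Finset.Icc 1 T, b t
  set D := ∑ t ∈ Finset.Icc 1 T, d t ^ 2
  have hcoef : L₄ * η ^ 2 / β ^ 2 ≤ 1 / 2 := by
    rw [div_le_iff₀ (by positivity)]
    linarith
  have hB : B ≤ L₂ / β + 1 / 2 * D + L₃ * β * T :=
    hii.trans (by gcongr)
  have hinit : 2 * a 1 ≤ η * (ε ^ 2 / 3 * T) := by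
    rw [div_le_iff₀ (by positivity)] at hcond4
    linarith
  have hvar : L₂ / β ≤ ε ^ 2 / 3 * T := by
    rwa [← div_div, div_le_iff₀ hT₀] at hcond3
  have hbias : L₃ * β * T ≤ ε ^ 2 / 3 * T := by gcongr
  have hG : G ≤ ε ^ 2 / 3 * T + B - 1 / 2 * D := by
    refine le_of_mul_le_mul_left ?_ hη
    linarith
  rw [one_div_mul_eq_div, div_le_iff₀ hT₀]
  linarith
end
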